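/- Let f ∈ H^∞(𝔹). Then f is cyclic in H²(𝔹) if and only if its symmetrization fˢ is cyclic in H²(𝔹). -/

import Mathlib

open MeasureTheory Filter Topology
open scoped ENNReal Classical

noncomputable section

/-! ### Basic quaternionic notions -/

instance : MeasurableSpace (Quaternion ℝ) := borel _
instance : BorelSpace (Quaternion ℝ) := ⟨rfl⟩

/-- The 2-sphere `𝕊` of quaternionic imaginary units. -/
def USphere : Set (Quaternion ℝ) := {q | q ^ 2 = -1}

/-- The open quaternionic unit ball `𝔹`. -/
def QBall : Set (Quaternion ℝ) := {q | ‖q‖ < 1}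

/-- The slice `L_I = ℝ + ℝI` through an imaginary unit `I`. -/
def sliceSet (I : Quaternion ℝ) : Set (Quaternion ℝ) :=
  {q | ∃ x y : ℝ, q = (x : Quaternion ℝ) + y • I}

/-- The point `e^{tI} = cos t + (sin t) I` of the boundary circle `∂𝔹_I`. -/
def ptOn (I : Quaternion ℝ) (t : ℝ) : Quaternion ℝ :=
  ((Real.cos t : ℝ) : Quaternion ℝ) + Real.sin t • I

/-- Slice regularity on the unit ball: on every slice the restriction of `f` has partial
derivatives satisfying the Cauchy–Riemann equation `∂f/∂x + I ∂f/∂y = 0`. -/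
def SliceRegular (f : Quaternion ℝ → Quaternion ℝ) : Prop :=
  ∀ I ∈ USphere, ∀ x y : ℝ, ((x : Quaternion ℝ) + y • I) ∈ QBall →
    ∃ fx fy : Quaternion ℝ,
      HasDerivAt (fun s : ℝ => f ((s : Quaternion ℝ) + y • I)) fx x ∧
      HasDerivAt (fun t : ℝ => f ((x : Quaternion ℝ) + t • I)) fy y ∧
      fx + I * fy = 0

/-! ### The Hardy space `H²(𝔹)` via power series coefficients.
A slice regular function on `𝔹` is identified with its coefficient sequence
`a : ℕ → ℍ`, the function being `q ↦ ∑ qⁿ aₙ`. -/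

/-- Membership in `H²(𝔹)`: square-summable coefficients. -/
def MemH2 (a : ℕ → Quaternion ℝ) : Prop := Summable (fun n => ‖a n‖ ^ 2)

/-- Evaluation of the power series `q ↦ ∑ qⁿ aₙ`. -/
def evalS (a : ℕ → Quaternion ℝ) (q : Quaternion ℝ) : Quaternion ℝ := ∑' n, q ^ n * a n

/-- The `*`-product (slice product) on coefficient sequences. -/
def sProd (a b : ℕ → Quaternion ℝ) : ℕ → Quaternion ℝ :=
  fun n => ∑ k ∈ Finset.range (n + 1), a k * b (n - k)

/-- The regular conjugate `fᶜ`. -/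
def conjS (a : ℕ → Quaternion ℝ) : ℕ → Quaternion ℝ := fun n => star (a n)

/-- The symmetrization `fˢ = f * fᶜ`. -/
def symmS (a : ℕ → Quaternion ℝ) : ℕ → Quaternion ℝ := sProd a (conjS a)

/-- The squared `H²` norm `∑ ‖aₙ‖²`. -/
def h2normSq (a : ℕ → Quaternion ℝ) : ℝ := ∑' n, ‖a n‖ ^ 2

/-- The `H²` norm. -/
def h2norm (a : ℕ → Quaternion ℝ) : ℝ := Real.sqrt (h2normSq a)

/-- The (right) quaternionic inner product `⟨f,g⟩ = ∑ conj(bₙ) aₙ` of `H²(𝔹)`. -/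
def h2inner (a b : ℕ → Quaternion ℝ) : Quaternion ℝ := ∑' n, star (b n) * a n

/-- Squared `H²`-distance of two coefficient sequences (valued in `ℝ≥0∞`). -/
def h2distSq (a b : ℕ → Quaternion ℝ) : ℝ≥0∞ := ∑' n, (‖a n - b n‖₊ : ℝ≥0∞) ^ 2

/-- The boundary value function of `f ∈ H²(𝔹)`, given by the radial limit where it exists. -/
def bdval (a : ℕ → Quaternion ℝ) (q : Quaternion ℝ) : Quaternion ℝ :=
  if h : ∃ L, Tendsto (fun r : ℝ => evalS a ((r : Quaternion ℝ) * q)) (𝓝[<] (1 : ℝ)) (𝓝 L)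
  then h.choose else 0

/-! ### The measure `Σ` on `∂𝔹` with `dΣ(e^{tI}) = dσ(I) dt`. -/

/-- The normalized area measure `σ` on the sphere `𝕊` of imaginary units
(2-dimensional Hausdorff measure, normalized so that `σ(𝕊) = 1`). -/
def sphMeasure : Measure (Quaternion ℝ) := (μH[2] USphere)⁻¹ • (μH[2]).restrict USphere

/-- The measure `Σ` on `∂𝔹`, `dΣ(e^{tI}) = dσ(I) dt`, normalized so `Σ(∂𝔹) = 1`. -/
def SigmaBd : Measure (Quaternion ℝ) :=
  (ENNReal.ofReal (2 * Real.pi))⁻¹ •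
    Measure.map (fun p : ℝ × Quaternion ℝ => ptOn p.2 p.1)
      ((volume.restrict (Set.Ico 0 (2 * Real.pi))).prod sphMeasure)

/-! ### Inner, outer, cyclic -/

/-- `f ∈ H^∞(𝔹)`: a bounded function of `H²(𝔹)`. -/
def MemHinf (a : ℕ → Quaternion ℝ) : Prop :=
  MemH2 a ∧ ∃ C : ℝ, ∀ q ∈ QBall, ‖evalS a q‖ ≤ C

/-- The `H^∞` norm: the sup of `‖f‖` on the ball. -/
def hInfNorm (a : ℕ → Quaternion ℝ) : ℝ := sSup ((fun q => ‖evalS a q‖) '' QBall)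

/-- `f` is inner: `f ∈ H^∞(𝔹)`, `‖f‖ ≤ 1` on `𝔹` and `‖f‖ = 1` `Σ`-a.e. on `∂𝔹`. -/
def IsInnerQ (a : ℕ → Quaternion ℝ) : Prop :=
  MemH2 a ∧ (∀ q ∈ QBall, ‖evalS a q‖ ≤ 1) ∧ (∀ᵐ q ∂SigmaBd, ‖bdval a q‖ = 1)

/-- `g` is outer: whenever `f ∈ H²(𝔹)` has the same boundary modulus `Σ`-a.e.,
then `‖g‖ ≥ ‖f‖` throughout `𝔹`. -/
def IsOuterQ (g : ℕ → Quaternion ℝ) : Prop :=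
  MemH2 g ∧ ∀ f, MemH2 f → (∀ᵐ q ∂SigmaBd, ‖bdval g q‖ = ‖bdval f q‖) →
    ∀ q ∈ QBall, ‖evalS f q‖ ≤ ‖evalS g q‖

/-- Quaternionic polynomials (finitely supported coefficient sequences). -/
def IsPolyQ (p : ℕ → Quaternion ℝ) : Prop := ∃ N, ∀ n > N, p n = 0

/-- Quaternionic polynomials of degree at most `n` (the space `𝒫_n`). -/
def IsPolyDeg (p : ℕ → Quaternion ℝ) (n : ℕ) : Prop := ∀ m > n, p m = 0

/-- The coefficient sequence of the monomial `qᵏ`. -/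
def qpow (k : ℕ) : ℕ → Quaternion ℝ := fun n => if n = k then 1 else 0

/-- The coefficient sequence of a constant function. -/
def constS (c : Quaternion ℝ) : ℕ → Quaternion ℝ := fun n => if n = 0 then c else 0

/-- The coefficient sequence of the constant function `1`. -/
def oneS : ℕ → Quaternion ℝ := constS 1

/-- The invariant subspace `[g]`: the `H²`-closure of `{g * p : p polynomial}`,
i.e. of the right span of `{qⁿ * g : n ≥ 0}`. -/
def InvSub (g : ℕ → Quaternion ℝ) : Set (ℕ → Quaternion ℝ) :=
  {h | MemH2 h ∧ ∀ ε : ℝ≥0∞, 0 < ε → ∃ p, IsPolyQ p ∧ h2distSq (sProd g p) h < ε}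

/-- `g` is cyclic: `[g] = H²(𝔹)`. -/
def IsCyclicQ (g : ℕ → Quaternion ℝ) : Prop :=
  MemH2 g ∧ ∀ h, MemH2 h → h ∈ InvSub g

/-! ### Bilateral (slice `L²`) series, used for boundary products -/

/-- Bilateral coefficients of `f̃(q) = f(q̄)` on `∂𝔹`: `Σ_{n ≤ 0} qⁿ a_{-n}`. -/
def tildeZ (a : ℕ → Quaternion ℝ) : ℤ → Quaternion ℝ :=
  fun k => if k ≤ 0 then a (-k).toNat else 0

/-- Bilateral coefficients of `fᶜ` on `∂𝔹`. -/
def conjZ (a : ℕ → Quaternion ℝ) : ℤ → Quaternion ℝ :=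
  fun k => if 0 ≤ k then star (a k.toNat) else 0

/-- The `*`-product of two slice `L²` functions on the boundary, on coefficients. -/
def convZ (c b : ℤ → Quaternion ℝ) : ℤ → Quaternion ℝ := fun n => ∑' k : ℤ, c k * b (n - k)

/-- Evaluation of a bilateral series `q ↦ ∑_{n ∈ ℤ} qⁿ dₙ`. -/
def evalZ (d : ℤ → Quaternion ℝ) (q : Quaternion ℝ) : Quaternion ℝ := ∑' n : ℤ, q ^ n * d n

/-- The slice inner product `⟨qᵏ * f, f⟩_I = (1/2π)∫₀^{2π} conj(f(e^{θI})) (e^{θI})ᵏ f(e^{θI}) dθ`,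
computed with boundary values; note `(qᵏ * f)(q) = qᵏ f(q)` pointwise. -/
def sliceInnerPow (a : ℕ → Quaternion ℝ) (I : Quaternion ℝ) (k : ℕ) : Quaternion ℝ :=
  (2 * Real.pi)⁻¹ •
    ∫ t in Set.Ico 0 (2 * Real.pi), star (bdval a (ptOn I t)) * ((ptOn I t) ^ k * bdval a (ptOn I t))

/-! ### Complex Hardy space `H²(𝔻)` notions (for slice restrictions) -/

/-- Membership in the complex Hardy space `H²(𝔻)` via coefficients. -/
def CMemH2 (c : ℕ → ℂ) : Prop := Summable (fun n => ‖c n‖ ^ 2)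

/-- Evaluation of a complex power series. -/
def cEval (c : ℕ → ℂ) (z : ℂ) : ℂ := ∑' n, z ^ n * c n

/-- Cauchy product of complex coefficient sequences. -/
def cConv (c d : ℕ → ℂ) : ℕ → ℂ := fun n => ∑ k ∈ Finset.range (n + 1), c k * d (n - k)

/-- Squared `H²(𝔻)` distance. -/
def cDistSq (c d : ℕ → ℂ) : ℝ≥0∞ := ∑' n, (‖c n - d n‖₊ : ℝ≥0∞) ^ 2

/-- Radial boundary values of a complex `H²` function. -/
def cBdval (c : ℕ → ℂ) (z : ℂ) : ℂ :=
  if h : ∃ L, Tendsto (fun r : ℝ => cEval c ((r : ℂ) * z)) (𝓝[<] (1 : ℝ)) (𝓝 L)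
  then h.choose else 0

/-- Lebesgue measure on the unit circle `∂𝔻` (parametrized by `θ ∈ [0, 2π)`). -/
def circleM : Measure ℂ :=
  Measure.map (fun t : ℝ => Complex.exp (t * Complex.I)) (volume.restrict (Set.Ico 0 (2 * Real.pi)))

/-- Cyclicity in `H²(𝔻)`: polynomial multiples of `c` are dense. -/
def CIsCyclic (c : ℕ → ℂ) : Prop :=
  CMemH2 c ∧ ∀ h, CMemH2 h → ∀ ε : ℝ≥0∞, 0 < ε →
    ∃ p : ℕ → ℂ, (∃ N, ∀ n > N, p n = 0) ∧ cDistSq (cConv c p) h < ε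

/-- Outerness in `H²(𝔻)` (in the sense matching Definition 2.10 of the paper). -/
def CIsOuter (c : ℕ → ℂ) : Prop :=
  CMemH2 c ∧ ∀ h, CMemH2 h →
    (∀ᵐ z ∂circleM, ‖cBdval c z‖ = ‖cBdval h z‖) →
    ∀ z ∈ Metric.ball (0 : ℂ) 1, ‖cEval h z‖ ≤ ‖cEval c z‖

/-- Complex coordinates of a point of the slice `L_I`: if `p = x + yI` then
`sliceToC I p = x + iy`. -/
def sliceToC (I : Quaternion ℝ) (p : Quaternion ℝ) : ℂ := ⟨p.re, -(p * I).re⟩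

/-- The quaternion `i`. -/
def qI : Quaternion ℝ := ⟨0, 1, 0, 0⟩

/-- The embedding of `ℂ = L_i` into the quaternions. -/
def cToQ (z : ℂ) : Quaternion ℝ := (z.re : Quaternion ℝ) + z.im • qI

/-- The imaginary unit `I_ω` identified by `ω` (any imaginary unit if `ω` is real). -/
def Iu (ω : Quaternion ℝ) : Quaternion ℝ := if ω.im = 0 then qI else ‖ω.im‖⁻¹ • ω.im

/-! ### Optimal approximants -/

/-- `p` is an optimal approximant of degree `n` of `f^{-*}`: `p ∈ 𝒫_n` minimizes
`‖f * p - 1‖_{H²}` among all `p ∈ 𝒫_n`. -/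
def IsOptApprox (a : ℕ → Quaternion ℝ) (n : ℕ) (p : ℕ → Quaternion ℝ) : Prop :=
  IsPolyDeg p n ∧ ∀ r, IsPolyDeg r n → h2distSq (sProd a p) oneS ≤ h2distSq (sProd a r) oneS

end

lemma HasSum.congr_fun' {f g : ℕ → ℂ} {a : ℂ} (h : HasSum f a) (e : ∀ n, g n = f n) :
    HasSum g a := by
  have : g = f := funext e
  rwa [this]

open ComplexConjugate in
lemma aux_parseval (c : ℕ → ℂ) (hc : Summable fun n => ‖c n‖) :
    ∫ x : AddCircle (1:ℝ), ‖∑' n : ℕ, c n * fourier (n:ℤ) x‖ ^ 2 ∂AddCircle.haarAddCircle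
      = ∑' n, ‖c n‖ ^ 2 := by
  have hs : Summable (fun n : ℕ => c n • (fourier (n:ℤ) : C(AddCircle (1:ℝ), ℂ))) := by
    apply Summable.of_norm
    have : ∀ n : ℕ, ‖(fourier (n:ℤ) : C(AddCircle (1:ℝ), ℂ))‖ = 1 := fun n => fourier_norm _
    simpa only [norm_smul, this, mul_one] using hc
  set G : C(AddCircle (1:ℝ), ℂ) := ∑' n : ℕ, c n • (fourier (n:ℤ) : C(AddCircle (1:ℝ), ℂ)) with hG
  have hGx : ∀ x, G x = ∑' n : ℕ, c n * fourier (n:ℤ) x := by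
    intro x
    rw [hG, ← ContinuousMap.tsum_apply hs]
    simp
  set T := ContinuousMap.toLp (E := ℂ) 2 (AddCircle.haarAddCircle (T := (1:ℝ))) ℂ with hT
  have hTs : HasSum (fun n : ℕ => c n • (fourierLp (T := (1:ℝ)) 2 (n:ℤ))) (T G) := by
    have := T.hasSum hs.hasSum
    simpa [map_smul, fourierLp] using this
  have hin : ∀ m : ℕ, inner ℂ (fourierLp (T := (1:ℝ)) 2 (m:ℤ)) (T G) = c m := by
    intro m
    have h1 := (innerSL ℂ (fourierLp (T := (1:ℝ)) 2 (m:ℤ))).hasSum hTs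
    have h2 : HasSum (fun n : ℕ => if n = m then c m else 0)
        (inner ℂ (fourierLp (T := (1:ℝ)) 2 (m:ℤ)) (T G)) := by
      refine h1.congr_fun' fun n => ?_
      rw [innerSL_apply_apply, inner_smul_right, orthonormal_iff_ite.1 (orthonormal_fourier (T := (1:ℝ)))]
      by_cases h : n = m
      · simp [h]
      · simp [h, Ne.symm h]
    exact h2.unique (hasSum_ite_eq m (c m))
  have h3 : HasSum (fun n => c n * conj (c n)) (inner ℂ (T G) (T G)) := by
    have h1 := (innerSL ℂ (T G)).hasSum hTs
    refine h1.congr_fun' fun n => ?_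
    rw [innerSL_apply_apply, inner_smul_right, ← inner_conj_symm, hin]
  have h4 : (inner ℂ (T G) (T G) : ℂ) = ((∫ x, ‖G x‖^2 ∂AddCircle.haarAddCircle : ℝ) : ℂ) := by
    rw [hT, ContinuousMap.inner_toLp, ← integral_complex_ofReal]
    congr 1
    ext x
    rw [Complex.mul_conj']; simp
  simp_rw [← hGx]
  rw [h4] at h3
  have h5 : HasSum (fun n => ((‖c n‖^2 : ℝ):ℂ)) ((∫ x, ‖G x‖^2 ∂AddCircle.haarAddCircle : ℝ) : ℂ) := by
    convert h3 using 2 with n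
    rw [Complex.mul_conj']; simp
  exact (Complex.hasSum_ofReal.1 h5).tsum_eq.symm

lemma aux_fnorm (n : ℤ) (x : AddCircle (1:ℝ)) : ‖fourier n x‖ = 1 := by
  rw [fourier_apply]; exact Circle.norm_coe _

lemma aux_cont (c : ℕ → ℂ) (hc : Summable fun n => ‖c n‖) :
    Continuous (fun x : AddCircle (1:ℝ) => ∑' n : ℕ, c n * fourier (n:ℤ) x) := by
  refine continuous_tsum (fun n => by fun_prop) hc ?_
  intro n x
  rw [norm_mul, aux_fnorm, mul_one]

lemma aux_cauchy (F G e : ℕ → ℂ) (he : ∀ n, ‖e n‖ = 1) (hadd : ∀ k m, e (k + m) = e k * e m)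
    (hF : Summable fun n => ‖F n‖) (hG : Summable fun n => ‖G n‖) :
    (∑' n, F n * e n) * (∑' n, G n * e n) =
      ∑' n, (∑ k ∈ Finset.range (n+1), F k * G (n-k)) * e n := by
  rw [tsum_mul_tsum_eq_tsum_sum_range_of_summable_norm]
  · refine tsum_congr fun n => ?_
    rw [Finset.sum_mul]
    refine Finset.sum_congr rfl fun k hk => ?_
    have : n = k + (n - k) := by simp at hk; omega
    conv_rhs => rw [this, hadd]
    rw [show k + (n-k) - k = n - k by omega]
    ring
  · simpa only [norm_mul, he, mul_one] using hF
  · simpa only [norm_mul, he, mul_one] using hG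

lemma aux_mult_rho (c s : ℕ → ℂ) (B C ρ : ℝ) (hρ0 : 0 < ρ) (hρ : ρ < 1)
    (hc : ∀ n, ‖c n‖ ≤ B) (hs : Summable fun n => ‖s n‖ ^ 2)
    (hC : ∀ z : ℂ, ‖z‖ < 1 → ‖∑' n, z ^ n * c n‖ ≤ C) :
    Summable (fun n => ‖(cConv c s n) * (ρ:ℂ) ^ n‖ ^ 2) ∧
    ∑' n, ‖(cConv c s n) * (ρ:ℂ) ^ n‖ ^ 2 ≤ C ^ 2 * ∑' n, ‖s n‖ ^ 2 := by
  have hgeo : Summable (fun n : ℕ => ρ ^ n) := summable_geometric_of_lt_one hρ0.le hρ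
  have hcs : Summable (fun n => ‖c n * (ρ:ℂ)^n‖) := by
    refine Summable.of_nonneg_of_le (fun _ => norm_nonneg _) (fun n => ?_) (hgeo.mul_left B)
    rw [norm_mul, norm_pow, Complex.norm_real, Real.norm_of_nonneg hρ0.le]
    gcongr; exact hc n
  obtain ⟨D, hD⟩ : ∃ D, ∀ n, ‖s n‖ ≤ D := by
    refine ⟨1 + ∑' n, ‖s n‖^2, fun n => ?_⟩
    have := hs.le_tsum n (fun _ _ => by positivity)
    nlinarith [sq_nonneg (‖s n‖ - 1)]
  have hss : Summable (fun n => ‖s n * (ρ:ℂ)^n‖) := by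
    refine Summable.of_nonneg_of_le (fun _ => norm_nonneg _) (fun n => ?_) (hgeo.mul_left D)
    rw [norm_mul, norm_pow, Complex.norm_real, Real.norm_of_nonneg hρ0.le]
    gcongr; exact hD n
  have hconv : ∀ n, cConv c s n * (ρ:ℂ)^n =
      ∑ k ∈ Finset.range (n+1), (c k * (ρ:ℂ)^k) * (s (n-k) * (ρ:ℂ)^(n-k)) := by
    intro n
    rw [cConv, Finset.sum_mul]
    refine Finset.sum_congr rfl fun k hk => ?_
    have : k + (n - k) = n := by simp at hk; omega
    conv_lhs => rw [← this, pow_add]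
    rw [show k + (n-k) - k = n - k by omega]
    ring
  have hcc : Summable (fun n => ‖cConv c s n * (ρ:ℂ)^n‖) := by
    have := summable_norm_sum_mul_range_of_summable_norm (f := fun n => c n * (ρ:ℂ)^n)
      (g := fun n => s n * (ρ:ℂ)^n) hcs hss
    refine this.congr fun n => ?_
    rw [hconv]
  have hprod : ∀ x : AddCircle (1:ℝ), ∑' n : ℕ, (cConv c s n * (ρ:ℂ)^n) * fourier (n:ℤ) x =
      (∑' n : ℕ, (c n * (ρ:ℂ)^n) * fourier (n:ℤ) x) * (∑' n : ℕ, (s n * (ρ:ℂ)^n) * fourier (n:ℤ) x) := by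
    intro x
    have := aux_cauchy (fun n => c n * (ρ:ℂ)^n) (fun n => s n * (ρ:ℂ)^n) (fun n => fourier (n:ℤ) x)
      (fun n => aux_fnorm _ x) (fun k m => by push_cast; exact fourier_add) hcs hss
    rw [this]
    exact tsum_congr fun n => by rw [hconv]
  have hbd : ∀ x : AddCircle (1:ℝ), ‖∑' n : ℕ, (c n * (ρ:ℂ)^n) * fourier (n:ℤ) x‖ ≤ C := by
    intro x
    have := hC (ρ * fourier 1 x) (by rw [norm_mul, aux_fnorm, mul_one, Complex.norm_real, Real.norm_of_nonneg hρ0.le]; exact hρ)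
    convert this using 3
    ext n
    rw [mul_pow, fourier_apply, fourier_apply]
    simp only [natCast_zsmul, one_smul, AddCircle.toCircle_nsmul, Circle.coe_pow]
    ring
  have hsq : Summable (fun n => ‖s n * (ρ:ℂ)^n‖ ^ 2) := by
    refine Summable.of_nonneg_of_le (fun _ => by positivity) (fun n => ?_) hs
    rw [norm_mul, norm_pow, Complex.norm_real, Real.norm_of_nonneg hρ0.le]
    gcongr
    exact mul_le_of_le_one_right (norm_nonneg _) (pow_le_one₀ hρ0.le hρ.le)
  have hC0 : 0 ≤ C := (norm_nonneg _).trans (hbd 0)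
  refine ⟨?_, ?_⟩
  · obtain ⟨D', hD'⟩ : ∃ D, ∀ n, ‖cConv c s n * (ρ:ℂ)^n‖ ≤ D :=
      ⟨∑' n, ‖cConv c s n * (ρ:ℂ)^n‖, fun n => hcc.le_tsum n (fun _ _ => by positivity)⟩
    refine Summable.of_nonneg_of_le (fun _ => by positivity) (fun n => ?_) (hcc.mul_left D')
    rw [sq]; gcongr; exact hD' n
  · rw [← aux_parseval _ hcc]
    calc _ ≤ ∫ x : AddCircle (1:ℝ), C^2 * ‖∑' n : ℕ, (s n * (ρ:ℂ)^n) * fourier (n:ℤ) x‖ ^ 2 ∂AddCircle.haarAddCircle := by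
            apply integral_mono
            · exact ((aux_cont _ hcc).norm.pow 2).integrable_of_hasCompactSupport (HasCompactSupport.of_compactSpace _)
            · exact (continuous_const.mul ((aux_cont _ hss).norm.pow 2)).integrable_of_hasCompactSupport (HasCompactSupport.of_compactSpace _)
            · intro x
              simp only [hprod, norm_mul, mul_pow]
              gcongr
              exact hbd x
      _ = C^2 * ∑' n, ‖s n * (ρ:ℂ)^n‖ ^ 2 := by
            rw [integral_const_mul, aux_parseval _ hss]
      _ ≤ _ := by
            gcongr with n
            rw [norm_mul, norm_pow, Complex.norm_real, Real.norm_of_nonneg hρ0.le]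
            exact mul_le_of_le_one_right (norm_nonneg _) (pow_le_one₀ hρ0.le hρ.le)

lemma aux_mult_c (c s : ℕ → ℂ) (B C : ℝ) 
    (hc : ∀ n, ‖c n‖ ≤ B) (hs : Summable fun n => ‖s n‖ ^ 2)
    (hC : ∀ z : ℂ, ‖z‖ < 1 → ‖∑' n, z ^ n * c n‖ ≤ C) (N : ℕ) :
    ∑ n ∈ Finset.range N, ‖cConv c s n‖ ^ 2 ≤ C ^ 2 * ∑' n, ‖s n‖ ^ 2 := by
  have hcont : Continuous (fun ρ : ℝ => ∑ n ∈ Finset.range N, ‖cConv c s n * (ρ:ℂ)^n‖ ^ 2) := by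
    fun_prop
  have ht : Tendsto (fun ρ : ℝ => ∑ n ∈ Finset.range N, ‖cConv c s n * (ρ:ℂ)^n‖ ^ 2) (𝓝[<] 1)
      (𝓝 (∑ n ∈ Finset.range N, ‖cConv c s n‖ ^ 2)) := by
    have := (hcont.tendsto 1).mono_left (nhdsWithin_le_nhds (s := Set.Iio 1))
    simpa using this
  refine le_of_tendsto ht ?_
  filter_upwards [Ioo_mem_nhdsLT (zero_lt_one (α := ℝ))] with ρ hρ
  obtain ⟨h1, h2⟩ := aux_mult_rho c s B C ρ hρ.1 hρ.2 hc hs hC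
  exact (h1.sum_le_tsum _ (fun _ _ => by positivity)).trans h2

/-- first complex coordinate -/
def qP1 (q : Quaternion ℝ) : ℂ := ⟨q.re, q.imI⟩
/-- second complex coordinate -/
def qP2 (q : Quaternion ℝ) : ℂ := ⟨q.imJ, q.imK⟩

def qJ : Quaternion ℝ := ⟨0, 0, 1, 0⟩

lemma q_normsq (q : Quaternion ℝ) : ‖q‖ ^ 2 = ‖qP1 q‖ ^ 2 + ‖qP2 q‖ ^ 2 := by
  rw [sq, ← Quaternion.normSq_eq_norm_mul_self, Quaternion.normSq_def', ← Complex.normSq_eq_norm_sq,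
    ← Complex.normSq_eq_norm_sq, Complex.normSq_apply, Complex.normSq_apply]
  simp only [qP1, qP2]
  ring

lemma qP1_mul (z : ℂ) (q : Quaternion ℝ) : qP1 ((z : Quaternion ℝ) * q) = z * qP1 q := by
  apply Complex.ext <;> simp [qP1]

lemma qP2_mul (z : ℂ) (q : Quaternion ℝ) : qP2 ((z : Quaternion ℝ) * q) = z * qP2 q := by
  apply Complex.ext <;> simp [qP2]

def qP1L : Quaternion ℝ →ₗ[ℝ] ℂ where
  toFun := qP1
  map_add' a b := by apply Complex.ext <;> simp [qP1]
  map_smul' a b := by apply Complex.ext <;> simp [qP1]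

def qP2L : Quaternion ℝ →ₗ[ℝ] ℂ where
  toFun := qP2
  map_add' a b := by apply Complex.ext <;> simp [qP2]
  map_smul' a b := by apply Complex.ext <;> simp [qP2]

lemma q_decomp (q : Quaternion ℝ) : q = (qP1 q : Quaternion ℝ) + (qP2 q : Quaternion ℝ) * qJ := by
  have h1 : qJ.re = 0 := rfl
  have h2 : qJ.imI = 0 := rfl
  have h3 : qJ.imJ = 1 := rfl
  have h4 : qJ.imK = 0 := rfl
  ext <;> simp [qP1, qP2, h1, h2, h3, h4]

lemma qP1_le (q : Quaternion ℝ) : ‖qP1 q‖ ≤ ‖q‖ := by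
  have := q_normsq q
  exact abs_le_of_sq_le_sq' (by nlinarith [sq_nonneg ‖qP2 q‖]) (norm_nonneg _) |>.2

lemma qP2_le (q : Quaternion ℝ) : ‖qP2 q‖ ≤ ‖q‖ := by
  have := q_normsq q
  exact abs_le_of_sq_le_sq' (by nlinarith [sq_nonneg ‖qP1 q‖]) (norm_nonneg _) |>.2

lemma q_norm_c (z : ℂ) : ‖(z : Quaternion ℝ)‖ = ‖z‖ := by
  have h := q_normsq (z : Quaternion ℝ)
  have h1 : qP1 (z : Quaternion ℝ) = z := by apply Complex.ext <;> simp [qP1]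
  have h2 : qP2 (z : Quaternion ℝ) = 0 := by apply Complex.ext <;> simp [qP2]
  rw [h1, h2] at h
  simpa using h

lemma q_pow_c (z : ℂ) (n : ℕ) : ((z ^ n : ℂ) : Quaternion ℝ) = (z : Quaternion ℝ) ^ n := by
  rw [← Quaternion.coe_ofComplex, map_pow]

lemma eval_bounds (a : ℕ → Quaternion ℝ) (ha : MemH2 a) (C : ℝ)
    (hC : ∀ q ∈ QBall, ‖evalS a q‖ ≤ C) (z : ℂ) (hz : ‖z‖ < 1) :
    ‖∑' n, z ^ n * qP1 (a n)‖ ≤ C ∧ ‖∑' n, z ^ n * qP2 (a n)‖ ≤ C := by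
  have hs : Summable (fun n => (z : Quaternion ℝ) ^ n * a n) := by
    apply Summable.of_norm
    obtain ⟨D, hD⟩ : ∃ D, ∀ n, ‖a n‖ ≤ D := by
      refine ⟨1 + ∑' n, ‖a n‖^2, fun n => ?_⟩
      have := ha.le_tsum n (fun _ _ => by positivity)
      nlinarith [sq_nonneg (‖a n‖ - 1)]
    refine Summable.of_nonneg_of_le (fun _ => norm_nonneg _) (fun n => ?_)
      ((summable_geometric_of_lt_one (norm_nonneg z) hz).mul_right D)
    rw [norm_mul, norm_pow, q_norm_c]
    gcongr; exact hD n
  have hq := hC (z : Quaternion ℝ) (by simpa [QBall, q_norm_c] using hz)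
  have h1 := (LinearMap.toContinuousLinearMap qP1L).hasSum hs.hasSum
  have h2 := (LinearMap.toContinuousLinearMap qP2L).hasSum hs.hasSum
  have e1 : ∑' n, z ^ n * qP1 (a n) = qP1 (evalS a z) := by
    refine HasSum.tsum_eq (HasSum.congr_fun' h1 fun n => ?_)
    change _ = qP1 _
    rw [← q_pow_c, qP1_mul]
  have e2 : ∑' n, z ^ n * qP2 (a n) = qP2 (evalS a z) := by
    refine HasSum.tsum_eq (HasSum.congr_fun' h2 fun n => ?_)
    change _ = qP2 _
    rw [← q_pow_c, qP2_mul]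
  rw [e1, e2]
  exact ⟨(qP1_le _).trans hq, (qP2_le _).trans hq⟩

/-- squared norm in `ℝ≥0∞` -/
noncomputable def N2 (a : ℕ → Quaternion ℝ) : ℝ≥0∞ := ∑' n, (‖a n‖₊ : ℝ≥0∞) ^ 2

lemma N2_term (x : Quaternion ℝ) : (‖x‖₊ : ℝ≥0∞) ^ 2 = ENNReal.ofReal (‖x‖ ^ 2) := by
  rw [ENNReal.ofReal_pow (norm_nonneg _), ofReal_norm]; rfl

lemma N2_eq (a : ℕ → Quaternion ℝ) (ha : MemH2 a) : N2 a = ENNReal.ofReal (∑' n, ‖a n‖ ^ 2) := by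
  rw [ENNReal.ofReal_tsum_of_nonneg (fun _ => by positivity) ha]
  simp only [N2, N2_term]

lemma memH2_iff (a : ℕ → Quaternion ℝ) : MemH2 a ↔ N2 a ≠ ⊤ := by
  constructor
  · intro h; rw [N2_eq a h]; exact ENNReal.ofReal_ne_top
  · intro h
    have := ENNReal.summable_toReal h
    refine this.congr fun n => ?_
    simp

lemma N2_add_le (a b : ℕ → Quaternion ℝ) : N2 (fun n => a n + b n) ≤ 2 * N2 a + 2 * N2 b := by
  unfold N2
  rw [← ENNReal.tsum_mul_left, ← ENNReal.tsum_mul_left, ← ENNReal.tsum_add]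
  refine ENNReal.tsum_le_tsum fun n => ?_
  have h : ‖a n + b n‖₊ ^ 2 ≤ 2 * ‖a n‖₊ ^ 2 + 2 * ‖b n‖₊ ^ 2 := by
    rw [← NNReal.coe_le_coe]
    push_cast
    have := norm_add_le (a n) (b n)
    nlinarith [sq_nonneg (‖a n‖ - ‖b n‖), norm_nonneg (a n + b n)]
  exact_mod_cast h

lemma N2_conj (a : ℕ → Quaternion ℝ) : N2 (conjS a) = N2 a := by
  simp [N2, conjS]

lemma N2_neg (a : ℕ → Quaternion ℝ) : N2 (fun n => - a n) = N2 a := by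
  simp [N2]

lemma h2dist_triangle (a b c : ℕ → Quaternion ℝ) :
    h2distSq a c ≤ 2 * h2distSq a b + 2 * h2distSq b c := by
  have := N2_add_le (fun n => a n - b n) (fun n => b n - c n)
  simpa [N2, h2distSq] using this

lemma sProd_ps (a b : ℕ → Quaternion ℝ) :
    PowerSeries.mk (sProd a b) = PowerSeries.mk a * PowerSeries.mk b := by
  ext1 n
  rw [PowerSeries.coeff_mk, PowerSeries.coeff_mul, Finset.Nat.sum_antidiagonal_eq_sum_range_succ_mk]
  simp [sProd]

lemma ps_inj {a b : ℕ → Quaternion ℝ} (h : PowerSeries.mk a = PowerSeries.mk b) : a = b := by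
  funext n
  have := congrArg (PowerSeries.coeff n) h
  simpa using this

lemma sProd_assoc (a b c : ℕ → Quaternion ℝ) : sProd (sProd a b) c = sProd a (sProd b c) := by
  apply ps_inj; simp only [sProd_ps, mul_assoc]

lemma sProd_one (a : ℕ → Quaternion ℝ) : sProd a oneS = a := by
  funext n
  rw [sProd, Finset.sum_eq_single n]
  · simp [oneS, constS]
  · intro k hk hkn
    have : n - k ≠ 0 := by simp at hk; omega
    simp [oneS, constS, this]
  · simp

lemma one_sProd (a : ℕ → Quaternion ℝ) : sProd oneS a = a := by
  funext n
  rw [sProd, Finset.sum_eq_single 0]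
  · simp [oneS, constS]
  · intro k hk hkn
    simp [oneS, constS, hkn]
  · simp

lemma conj_sProd (a b : ℕ → Quaternion ℝ) :
    conjS (sProd a b) = sProd (conjS b) (conjS a) := by
  funext n
  simp only [conjS, sProd, star_sum, star_mul]
  rw [← Finset.sum_range_reflect]
  refine Finset.sum_congr rfl fun k hk => ?_
  have : k ≤ n := by simp at hk; omega
  rw [show n + 1 - 1 - k = n - k by omega, show n - (n - k) = k by omega]

lemma conj_conj (a : ℕ → Quaternion ℝ) : conjS (conjS a) = a := by
  funext n; simp [conjS]

lemma sProd_sub (a b c : ℕ → Quaternion ℝ) :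
    sProd a (fun n => b n - c n) = fun n => sProd a b n - sProd a c n := by
  funext n; simp [sProd, mul_sub]

lemma sub_sProd (a b c : ℕ → Quaternion ℝ) :
    sProd (fun n => b n - c n) a = fun n => sProd b a n - sProd c a n := by
  funext n; simp [sProd, sub_mul]

def IsMult (a : ℕ → Quaternion ℝ) : Prop := ∃ K : ℝ≥0∞, K ≠ ⊤ ∧ ∀ b, N2 (sProd a b) ≤ K * N2 b

lemma mult_complex (c : ℕ → ℂ) (B C : ℝ) (hc : ∀ n, ‖c n‖ ≤ B)
    (hC : ∀ z : ℂ, ‖z‖ < 1 → ‖∑' n, z ^ n * c n‖ ≤ C) (b : ℕ → Quaternion ℝ) (hb : MemH2 b) :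
    N2 (sProd (fun n => (c n : Quaternion ℝ)) b) ≤ ENNReal.ofReal (C ^ 2) * N2 b := by
  have e1 : ∀ n, qP1 (sProd (fun n => (c n : Quaternion ℝ)) b n) = cConv c (fun n => qP1 (b n)) n := by
    intro n
    change qP1L _ = _
    simp only [sProd, cConv, map_sum]
    exact Finset.sum_congr rfl fun k _ => qP1_mul _ _
  have e2 : ∀ n, qP2 (sProd (fun n => (c n : Quaternion ℝ)) b n) = cConv c (fun n => qP2 (b n)) n := by
    intro n
    change qP2L _ = _
    simp only [sProd, cConv, map_sum]
    exact Finset.sum_congr rfl fun k _ => qP2_mul _ _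
  have s1 : Summable (fun n => ‖qP1 (b n)‖ ^ 2) :=
    Summable.of_nonneg_of_le (fun _ => by positivity)
      (fun n => by gcongr; exact qP1_le _) hb
  have s2 : Summable (fun n => ‖qP2 (b n)‖ ^ 2) :=
    Summable.of_nonneg_of_le (fun _ => by positivity)
      (fun n => by gcongr; exact qP2_le _) hb
  rw [N2_eq b hb, ← ENNReal.ofReal_mul (by positivity)]
  refine ENNReal.tsum_le_of_sum_range_le fun N => ?_
  simp only [N2_term]
  rw [← ENNReal.ofReal_sum_of_nonneg (fun _ _ => by positivity)]
  apply ENNReal.ofReal_le_ofReal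
  simp only [q_normsq, e1, e2]
  rw [Finset.sum_add_distrib, s1.tsum_add s2, mul_add]
  exact add_le_add (aux_mult_c _ _ B C hc s1 hC N) (aux_mult_c _ _ B C hc s2 hC N)

lemma isMult_of_memHinf (a : ℕ → Quaternion ℝ) (ha : MemHinf a) : IsMult a := by
  obtain ⟨h2, C, hC⟩ := ha
  obtain ⟨D, hD⟩ : ∃ D, ∀ n, ‖a n‖ ≤ D := by
    refine ⟨1 + ∑' n, ‖a n‖^2, fun n => ?_⟩
    have := h2.le_tsum n (fun _ _ => by positivity)
    nlinarith [sq_nonneg (‖a n‖ - 1)]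
  refine ⟨4 * ENNReal.ofReal (C ^ 2) + 1,
    ENNReal.add_ne_top.2 ⟨ENNReal.mul_ne_top (by norm_num) ENNReal.ofReal_ne_top, by norm_num⟩,
    fun b => ?_⟩
  by_cases hb : MemH2 b
  swap
  · have : N2 b = ⊤ := by by_contra h; exact hb ((memH2_iff b).2 h)
    rw [this, ENNReal.mul_top (by simp)]
    exact le_top
  have hJ : ∀ x : Quaternion ℝ, ‖qJ * x‖ = ‖x‖ := by
    intro x
    have : ‖qJ‖ ^ 2 = 1 := by
      rw [sq, ← Quaternion.normSq_eq_norm_mul_self, Quaternion.normSq_def']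
      simp [qJ]
    have : ‖qJ‖ = 1 := by nlinarith [norm_nonneg qJ]
    rw [norm_mul, this, one_mul]
  have hb' : MemH2 (fun n => qJ * b n) := by simpa only [MemH2, hJ] using hb
  have hN : N2 (fun n => qJ * b n) = N2 b := by
    rw [N2_eq _ hb, N2_eq _ hb']; simp only [hJ]
  have e : sProd a b = fun n => sProd (fun n => (qP1 (a n) : Quaternion ℝ)) b n
      + sProd (fun n => (qP2 (a n) : Quaternion ℝ)) (fun n => qJ * b n) n := by
    funext n
    simp only [sProd, ← Finset.sum_add_distrib]
    refine Finset.sum_congr rfl fun k _ => ?_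
    conv_lhs => rw [q_decomp (a k)]
    rw [add_mul, mul_assoc]
  have m1 := mult_complex (fun n => qP1 (a n)) D C (fun n => (qP1_le _).trans (hD n))
    (fun z hz => (eval_bounds a h2 C hC z hz).1) b hb
  have m2 := mult_complex (fun n => qP2 (a n)) D C (fun n => (qP2_le _).trans (hD n))
    (fun z hz => (eval_bounds a h2 C hC z hz).2) _ hb'
  rw [hN] at m2
  rw [e]
  calc _ ≤ _ := N2_add_le _ _
    _ ≤ 2 * (ENNReal.ofReal (C ^ 2) * N2 b) + 2 * (ENNReal.ofReal (C ^ 2) * N2 b) := by gcongr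
    _ = 4 * ENNReal.ofReal (C ^ 2) * N2 b := by ring
    _ ≤ _ := by gcongr; exact le_self_add

lemma poly_memH2 (p : ℕ → Quaternion ℝ) (hp : IsPolyQ p) : MemH2 p := by
  obtain ⟨N, hN⟩ := hp
  apply summable_of_ne_finset_zero (s := Finset.range (N+1))
  intro n hn
  simp at hn
  simp [hN n (by omega)]

lemma poly_memHinf (p : ℕ → Quaternion ℝ) (hp : IsPolyQ p) : MemHinf p := by
  refine ⟨poly_memH2 p hp, ?_⟩
  obtain ⟨N, hN⟩ := hp
  refine ⟨∑ n ∈ Finset.range (N+1), ‖p n‖, fun q hq => ?_⟩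
  rw [evalS, tsum_eq_sum (s := Finset.range (N+1))]
  · refine (norm_sum_le _ _).trans (Finset.sum_le_sum fun n _ => ?_)
    rw [norm_mul, norm_pow]
    exact mul_le_of_le_one_left (norm_nonneg _) (pow_le_one₀ (norm_nonneg _) (le_of_lt hq))
  · intro n hn
    simp at hn
    simp [hN n (by omega)]

lemma IsMult.memH2 {a b : ℕ → Quaternion ℝ} (ha : IsMult a) (hb : MemH2 b) : MemH2 (sProd a b) := by
  obtain ⟨K, hK, h⟩ := ha
  rw [memH2_iff] at *
  exact ne_top_of_le_ne_top (ENNReal.mul_ne_top hK hb) (h b)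

lemma IsMult.mul {a b : ℕ → Quaternion ℝ} (ha : IsMult a) (hb : IsMult b) : IsMult (sProd a b) := by
  obtain ⟨K, hK, h⟩ := ha
  obtain ⟨L, hL, h'⟩ := hb
  refine ⟨K * L, ENNReal.mul_ne_top hK hL, fun c => ?_⟩
  rw [sProd_assoc, mul_assoc]
  exact (h _).trans (by gcongr; exact h' c)

lemma poly_conj (p : ℕ → Quaternion ℝ) (hp : IsPolyQ p) : IsPolyQ (conjS p) := by
  obtain ⟨N, hN⟩ := hp
  exact ⟨N, fun n hn => by simp [conjS, hN n hn]⟩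

lemma poly_mul (p r : ℕ → Quaternion ℝ) (hp : IsPolyQ p) (hr : IsPolyQ r) : IsPolyQ (sProd p r) := by
  obtain ⟨N, hN⟩ := hp
  obtain ⟨M, hM⟩ := hr
  refine ⟨N + M, fun n hn => Finset.sum_eq_zero fun k hk => ?_⟩
  by_cases h : k > N
  · simp [hN k h]
  · simp [hM (n - k) (by omega)]

/-- right multiplication by a polynomial is bounded -/
lemma poly_right (p : ℕ → Quaternion ℝ) (hp : IsPolyQ p) :
    ∃ K : ℝ≥0∞, K ≠ ⊤ ∧ ∀ b, N2 (sProd b p) ≤ K * N2 b := by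
  obtain ⟨K, hK, h⟩ := isMult_of_memHinf _ (poly_memHinf _ (poly_conj p hp))
  refine ⟨K, hK, fun b => ?_⟩
  have := h (conjS b)
  rwa [← conj_sProd, N2_conj, N2_conj] at this

noncomputable def truncS (a : ℕ → Quaternion ℝ) (N : ℕ) : ℕ → Quaternion ℝ := fun n => if n < N then a n else 0

lemma truncS_poly (a : ℕ → Quaternion ℝ) (N : ℕ) : IsPolyQ (truncS a N) :=
  ⟨N, fun n hn => by simp [truncS, show ¬ n < N by omega]⟩

lemma truncS_tendsto (a : ℕ → Quaternion ℝ) (ha : MemH2 a) :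
    Tendsto (fun N => N2 (fun n => a n - truncS a N n)) atTop (𝓝 0) := by
  have h := (memH2_iff a).1 ha
  have := ENNReal.tendsto_sum_nat_add (fun n => (‖a n‖₊ : ℝ≥0∞) ^ 2) h
  refine this.congr fun N => ?_
  rw [N2, ← ENNReal.summable.sum_add_tsum_nat_add' (k := N)
    (f := fun n => (‖a n - truncS a N n‖₊ : ℝ≥0∞) ^ 2)]
  rw [Finset.sum_eq_zero, zero_add]
  · refine tsum_congr fun n => ?_
    simp [truncS]
  · intro n hn
    simp at hn
    simp [truncS, hn]

lemma N2_sub_comm (a b : ℕ → Quaternion ℝ) :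
    N2 (fun n => a n - b n) = N2 (fun n => b n - a n) := by
  rw [← N2_neg]; simp

lemma cyclic_of_symm (f : ℕ → Quaternion ℝ) (hf : MemHinf f) (h : IsCyclicQ (symmS f)) :
    IsCyclicQ f := by
  refine ⟨hf.1, fun g hg => ⟨hg, fun ε hε => ?_⟩⟩
  obtain ⟨K, hK, hm⟩ := isMult_of_memHinf f hf
  obtain ⟨p, hp, hd⟩ := (h.2 g hg).2 (ε / 4) (ENNReal.div_pos hε.ne' (by norm_num))
  have hc : MemH2 (sProd (conjS f) p) := by
    obtain ⟨L, hL, h'⟩ := poly_right p hp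
    rw [memH2_iff]
    refine ne_top_of_le_ne_top (ENNReal.mul_ne_top hL ?_) (h' _)
    rw [N2_conj]
    exact (memH2_iff f).1 hf.1
  have ht := ENNReal.Tendsto.const_mul (truncS_tendsto _ hc) (Or.inr hK)
  rw [mul_zero] at ht
  obtain ⟨N, hN⟩ := (ht.eventually_lt_const (u := ε / 4) (ENNReal.div_pos hε.ne' (by norm_num))).exists
  refine ⟨_, truncS_poly (sProd (conjS f) p) N, ?_⟩
  have h1 : h2distSq (sProd f (truncS (sProd (conjS f) p) N)) (sProd (symmS f) p) < ε / 4 := by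
    refine lt_of_le_of_lt ?_ hN
    refine le_trans (le_of_eq ?_) (hm _)
    rw [sProd_sub, N2_sub_comm, symmS, sProd_assoc]
    rfl
  calc _ ≤ _ := h2dist_triangle _ (sProd (symmS f) p) _
    _ < 2 * (ε / 4) + 2 * (ε / 4) := by
      refine ENNReal.add_lt_add ?_ ?_ <;>
      exact (ENNReal.mul_lt_mul_iff_right (by norm_num) (by norm_num)).2 (by assumption)
    _ = ε := by
      rw [← add_mul, ← mul_div_assoc]
      norm_num
      rw [mul_comm, mul_div_assoc, ENNReal.div_self (by norm_num) (by norm_num), mul_one]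

section HilbertPart

variable {V : Type*} [NormedAddCommGroup V] [InnerProductSpace ℝ V]

lemma memlp_of_sq (x : ℕ → V) (hx : Summable fun n => ‖x n‖ ^ 2) :
    Memℓp x 2 := by
  apply memℓp_gen
  simpa using hx

/-- package a square-summable sequence -/
def mkE (x : ℕ → V) (hx : Summable fun n => ‖x n‖ ^ 2) : lp (fun _ : ℕ => V) 2 :=
  ⟨x, memlp_of_sq x hx⟩

lemma mkE_inner (x y : ℕ → V) (hx : Summable fun n => ‖x n‖ ^ 2)
    (hy : Summable fun n => ‖y n‖ ^ 2) :
    HasSum (fun n => inner ℝ (x n) (y n)) (inner ℝ (mkE x hx) (mkE y hy)) :=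
  lp.hasSum_inner (𝕜 := ℝ) (mkE x hx) (mkE y hy)

lemma lp_normsq (x : lp (fun _ : ℕ => V) 2) : HasSum (fun n => ‖x n‖ ^ 2) (‖x‖ ^ 2) := by
  have := lp.hasSum_inner (𝕜 := ℝ) x x
  simpa only [real_inner_self_eq_norm_sq] using this

lemma lp_sq (x : lp (fun _ : ℕ => V) 2) : Summable (fun n => ‖x n‖ ^ 2) := (lp_normsq x).summable

lemma cs_sq (x y : ℕ → V) (hx : Summable fun n => ‖x n‖ ^ 2)
    (hy : Summable fun n => ‖y n‖ ^ 2) :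
    Summable (fun n => inner ℝ (x n) (y n)) ∧
    |∑' n, inner ℝ (x n) (y n)| ≤ √(∑' n, ‖x n‖ ^ 2) * √(∑' n, ‖y n‖ ^ 2) := by
  have h := mkE_inner x y hx hy
  refine ⟨h.summable, ?_⟩
  rw [h.tsum_eq]
  have h1 : ∑' n, ‖x n‖ ^ 2 = ‖mkE x hx‖ ^ 2 := (lp_normsq (mkE x hx)).tsum_eq
  have h2 : ∑' n, ‖y n‖ ^ 2 = ‖mkE y hy‖ ^ 2 := (lp_normsq (mkE y hy)).tsum_eq
  rw [h1, h2, Real.sqrt_sq (norm_nonneg _), Real.sqrt_sq (norm_nonneg _)]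
  exact abs_real_inner_le_norm _ _

end HilbertPart

/-- right shift by `j` -/
def shiftR {V : Type*} [Zero V] (j : ℕ) (g : ℕ → V) (n : ℕ) : V := if j ≤ n then g (n - j) else 0

lemma hasSum_shift {F : ℕ → ℝ} {a : ℝ} (j : ℕ) (hF : ∀ n < j, F n = 0)
    (h : HasSum (fun k => F (k + j)) a) : HasSum F a := by
  refine (Function.Injective.hasSum_iff (add_left_injective j) ?_).1 h
  intro n hn
  apply hF
  by_contra hc
  exact hn ⟨n - j, by simp; omega⟩

lemma shiftR_sq (j : ℕ) (g : ℕ → ℝ) (hg : Summable fun n => ‖g n‖ ^ 2) :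
    Summable (fun n => ‖shiftR j g n‖ ^ 2) := by
  refine (hasSum_shift j ?_ (a := ∑' n, ‖g n‖ ^ 2) ?_).summable
  · intro n hn
    simp [shiftR, show ¬ j ≤ n by omega]
  · simpa [shiftR] using hg.hasSum

lemma hasSum_congrR {f g : ℕ → ℝ} {a : ℝ} (h : HasSum f a) (e : ∀ n, g n = f n) : HasSum g a := by
  rwa [show g = f from funext e]

lemma re_sumQ (S : Finset ℕ) (F : ℕ → Quaternion ℝ) : (∑ m ∈ S, F m).re = ∑ m ∈ S, (F m).re := by
  induction S using Finset.induction_on with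
  | empty => rfl
  | insert a S ha ih => rw [Finset.sum_insert ha, Finset.sum_insert ha, Quaternion.re_add, ih]

lemma lemmaR (g : ℕ → ℝ) (hg : Summable fun n => ‖g n‖ ^ 2) :
    ∃ φ : ℕ → ℝ, Summable (fun n => ‖φ n‖ ^ 2) ∧
      (∀ j, HasSum (fun n => shiftR j g n * φ n) (if j = 0 then g 0 else 0)) ∧
      (∀ k, 1 ≤ k → HasSum (fun n => φ n * φ (n + k)) 0) ∧
      (∑' n, ‖φ n‖ ^ 2 = φ 0) ∧
      (φ 0 = 1 → ∀ ε > 0, ∃ c : ℕ →₀ ℝ, ∃ S : ℝ, S < ε ∧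
        HasSum (fun n => ‖(∑ j ∈ c.support, c j * shiftR j g n) - (if n = 0 then 1 else 0)‖ ^ 2) S) := by
  let E := lp (fun _ : ℕ => ℝ) 2
  let v : ℕ → E := fun j => mkE (shiftR j g) (shiftR_sq j g hg)
  let M : Submodule ℝ E := (Submodule.span ℝ (Set.range v)).topologicalClosure
  have hMc : IsClosed (M : Set E) := Submodule.isClosed_topologicalClosure _
  haveI : CompleteSpace M := hMc.completeSpace_coe
  have he0 : Summable (fun n : ℕ => ‖(if n = 0 then (1:ℝ) else 0)‖ ^ 2) := by
    apply summable_of_ne_finset_zero (s := {0})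
    intro n hn
    simp at hn
    simp [hn]
  let e0 : E := mkE (fun n : ℕ => if n = 0 then (1:ℝ) else 0) he0
  have hin0 : ∀ x : E, inner ℝ x e0 = x 0 := by
    intro x
    have h1 := lp.hasSum_inner (𝕜 := ℝ) x e0
    have h2 : HasSum (fun n => inner ℝ (x n) (e0 n)) (x 0) := by
      have := hasSum_ite_eq (0:ℕ) (x 0)
      convert this using 2 with n
      change inner ℝ (x n) (if n = 0 then (1:ℝ) else 0) = _
      split_ifs with h
      · simp [h]
      · simp
    exact h1.unique h2
  obtain ⟨φ, hφM, w, hw, he⟩ := M.exists_add_mem_mem_orthogonal e0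
  have hort : ∀ x ∈ M, inner ℝ x φ = x 0 := by
    intro x hx
    have h1 := (Submodule.mem_orthogonal M w).1 hw x hx
    have h2 := hin0 x
    rw [he, inner_add_right, h1, add_zero] at h2
    exact h2
  have hvM : ∀ j, v j ∈ M := fun j =>
    Submodule.le_topologicalClosure _ (Submodule.subset_span ⟨j, rfl⟩)
  have ha : ∀ j, HasSum (fun n => shiftR j g n * φ n) (if j = 0 then g 0 else 0) := by
    intro j
    have h1 := lp.hasSum_inner (𝕜 := ℝ) (v j) φ
    rw [hort _ (hvM j)] at h1
    have h3 : (v j) 0 = if j = 0 then g 0 else 0 := by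
      change shiftR j g 0 = _
      by_cases h : j = 0 <;> simp [shiftR, h]
    rw [h3] at h1
    refine hasSum_congrR h1 fun n => ?_
    change _ = inner ℝ (shiftR j g n) (φ n)
    simp [mul_comm]
  have hsh : ∀ k, Summable (fun n => ‖φ (n + k)‖ ^ 2) := fun k =>
    (summable_nat_add_iff k).2 (lp_sq φ)
  have hb : ∀ k, 1 ≤ k → HasSum (fun n => φ n * φ (n + k)) 0 := by
    intro k hk
    let ψ : E := mkE (fun n => φ (n + k)) (hsh k)
    have hv : ∀ j, inner ℝ (v j) ψ = 0 := by
      intro j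
      have h1 := lp.hasSum_inner (𝕜 := ℝ) (v j) ψ
      have h2 := ha (j + k)
      rw [if_neg (by omega)] at h2
      have h3 : HasSum (fun n => inner ℝ ((v j) n) (ψ n)) 0 := by
        have h4 : ∀ n ∉ Set.range (fun n => n + k), shiftR (j+k) g n * φ n = 0 := by
          intro n hn
          have : ¬ (j + k ≤ n) := fun hc => hn ⟨n - k, by simp; omega⟩
          simp [shiftR, this]
        have h5 := (Function.Injective.hasSum_iff (add_left_injective k) h4).2 h2
        convert h5 using 2 with n
        change inner ℝ (shiftR j g n) (φ (n + k)) = shiftR (j+k) g (n+k) * φ (n + k)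
        simp [shiftR, mul_comm, Nat.add_sub_add_right]
      exact h1.unique h3
    have hsub : M ≤ (Submodule.span ℝ {ψ})ᗮ := by
      apply Submodule.topologicalClosure_minimal _ _ (Submodule.isClosed_orthogonal _)
      rw [Submodule.span_le]
      rintro _ ⟨j, rfl⟩
      rw [SetLike.mem_coe, Submodule.mem_orthogonal_singleton_iff_inner_left]
      exact hv j
    have h6 := (Submodule.mem_orthogonal_singleton_iff_inner_left).1 (hsub hφM)
    have h7 := lp.hasSum_inner (𝕜 := ℝ) φ ψ
    rw [h6] at h7
    refine hasSum_congrR h7 fun n => ?_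
    change _ = inner ℝ (φ n) (φ (n + k))
    simp [mul_comm]
  have hc : ‖φ‖ ^ 2 = φ 0 := by
    rw [← hort φ hφM, real_inner_self_eq_norm_sq]
  refine ⟨φ, lp_sq φ, ha, hb, ?_, ?_⟩
  · rw [(lp_normsq φ).tsum_eq, hc]
  · intro h1 ε hε
    have h2 : ‖e0 - φ‖ ^ 2 = 0 := by
      rw [norm_sub_sq_real, real_inner_comm, hin0, hc, h1, ← real_inner_self_eq_norm_sq, hin0]
      change (if (0:ℕ) = 0 then (1:ℝ) else 0) - 2 * 1 + 1 = 0
      norm_num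
    have h3 : e0 = φ := by
      rw [← sub_eq_zero, ← norm_eq_zero]
      exact pow_eq_zero_iff (two_ne_zero) |>.1 h2
    have h4 : e0 ∈ closure ((Submodule.span ℝ (Set.range v) : Submodule ℝ E) : Set E) := by
      rw [h3]; exact hφM
    obtain ⟨y, hy, hd⟩ := Metric.mem_closure_iff.1 h4 (√ε) (Real.sqrt_pos.2 hε)
    obtain ⟨c, rfl⟩ := Finsupp.mem_span_range_iff_exists_finsupp.1 hy
    refine ⟨c, ‖(c.sum fun i a => a • v i) - e0‖ ^ 2, ?_, ?_⟩
    · rw [dist_comm, dist_eq_norm] at hd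
      calc _ < (√ε) ^ 2 := by gcongr
        _ = ε := Real.sq_sqrt hε.le
    · refine hasSum_congrR (lp_normsq ((c.sum fun i a => a • v i) - e0)) fun n => ?_
      rw [lp.coeFn_sub, Pi.sub_apply, Finsupp.sum, lp.coeFn_sum, Finset.sum_apply]
      rfl

lemma sProd_shift (a p : ℕ → Quaternion ℝ) (S : Finset ℕ) (hp : ∀ j ∉ S, p j = 0) (n : ℕ) :
    sProd a p n = ∑ j ∈ S, shiftR j a n * p j := by
  have h1 : sProd a p n = ∑ j ∈ Finset.range (n+1), shiftR j a n * p j := by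
    rw [sProd, ← Finset.sum_range_reflect]
    refine Finset.sum_congr rfl fun k hk => ?_
    have : k ≤ n := by simp at hk; omega
    rw [shiftR, if_pos this, show n + 1 - 1 - k = n - k by omega, show n - (n - k) = k by omega]
  have h2 : ∑ j ∈ Finset.range (n+1), shiftR j a n * p j =
      ∑ j ∈ Finset.range (n+1) ∪ S, shiftR j a n * p j := by
    refine Finset.sum_subset Finset.subset_union_left fun j _ hj => ?_
    simp at hj
    simp [shiftR, show ¬ j ≤ n by omega]
  have h3 : ∑ j ∈ S, shiftR j a n * p j =
      ∑ j ∈ Finset.range (n+1) ∪ S, shiftR j a n * p j := by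
    refine Finset.sum_subset Finset.subset_union_right fun j _ hj => ?_
    simp [hp j hj]
  rw [h1, h2, h3]

lemma summable_corr (φ : ℕ → ℝ) (hφ : Summable fun n => ‖φ n‖ ^ 2) (k m : ℕ) :
    Summable (fun n => φ (n + k) * φ (n + m)) := by
  refine Summable.of_norm_bounded
    (((summable_nat_add_iff k).2 hφ).add ((summable_nat_add_iff m).2 hφ)) fun n => ?_
  rw [norm_mul]
  nlinarith [sq_nonneg (‖φ (n+k)‖ - ‖φ (n+m)‖), sq_nonneg ‖φ (n+k)‖, sq_nonneg ‖φ (n+m)‖]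

lemma corr_shift (φ : ℕ → ℝ) (hφ : Summable fun n => ‖φ n‖ ^ 2)
    (hb : ∀ k, 1 ≤ k → HasSum (fun n => φ n * φ (n + k)) 0) (M m m' : ℕ) (hm : m < M) (hm' : m' < M) :
    HasSum (fun n => shiftR M φ (n + m) * shiftR M φ (n + m'))
      (if m = m' then ∑' n, ‖φ n‖ ^ 2 else 0) := by
  wlog hle : m ≤ m' generalizing m m'
  · have := this m' m hm' hm (by omega)
    simp only [mul_comm (shiftR M φ (_ + m))]
    simpa only [eq_comm] using this
  apply hasSum_shift (M - m)
  · intro n hn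
    simp [shiftR, show ¬ M ≤ n + m by omega]
  · have e : ∀ k, shiftR M φ (k + (M - m) + m) * shiftR M φ (k + (M - m) + m') = φ k * φ (k + (m' - m)) := by
      intro k
      rw [shiftR, shiftR, if_pos (by omega), if_pos (by omega)]
      congr 2 <;> omega
    simp only [e]
    split_ifs with h
    · subst h
      simpa [← sq] using hφ.hasSum
    · exact hb _ (by omega)

lemma hankel_y (φ : ℕ → ℝ) (hφ : Summable fun n => ‖φ n‖ ^ 2)
    (hb : ∀ k, 1 ≤ k → HasSum (fun n => φ n * φ (n + k)) 0) (M : ℕ) (v : ℕ → Quaternion ℝ) :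
    Summable (fun k => ‖∑ m ∈ Finset.range M, φ (k + m) • v m‖ ^ 2) ∧
    ∑' k, ‖∑ m ∈ Finset.range M, φ (k + m) • v m‖ ^ 2 ≤
      (∑' n, ‖φ n‖ ^ 2) * ∑ m ∈ Finset.range M, ‖v m‖ ^ 2 := by
  have hY : HasSum (fun n => ‖∑ m ∈ Finset.range M, shiftR M φ (n + m) • v m‖ ^ 2)
      ((∑' n, ‖φ n‖ ^ 2) * ∑ m ∈ Finset.range M, ‖v m‖ ^ 2) := by
    have h1 : HasSum (fun n => ∑ m ∈ Finset.range M, ∑ m' ∈ Finset.range M,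
        (shiftR M φ (n + m) * shiftR M φ (n + m')) * inner ℝ (v m) (v m'))
        (∑ m ∈ Finset.range M, ∑ m' ∈ Finset.range M,
          (if m = m' then ∑' n, ‖φ n‖ ^ 2 else 0) * inner ℝ (v m) (v m')) := by
      refine hasSum_sum fun m hm => hasSum_sum fun m' hm' => HasSum.mul_right _ ?_
      exact corr_shift φ hφ hb M m m' (by simpa using hm) (by simpa using hm')
    convert h1 using 1
    · funext n
      rw [← real_inner_self_eq_norm_sq, sum_inner]
      refine Finset.sum_congr rfl fun m _ => ?_
      rw [inner_sum]
      refine Finset.sum_congr rfl fun m' _ => ?_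
      rw [real_inner_smul_left, real_inner_smul_right, mul_assoc]
    · rw [Finset.mul_sum]
      refine Finset.sum_congr rfl fun m hm => ?_
      simp only [ite_mul, zero_mul]
      rw [Finset.sum_ite_eq, if_pos hm, real_inner_self_eq_norm_sq]
  have e : ∀ k, ∑ m ∈ Finset.range M, φ (k + m) • v m =
      ∑ m ∈ Finset.range M, shiftR M φ (k + M + m) • v m := by
    intro k
    refine Finset.sum_congr rfl fun m _ => ?_
    rw [shiftR, if_pos (by omega)]
    congr 2; omega
  simp only [e]
  refine ⟨(summable_nat_add_iff (f := fun n => ‖∑ m ∈ Finset.range M, shiftR M φ (n + m) • v m‖ ^ 2) M).2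
    hY.summable, ?_⟩
  rw [← hY.tsum_eq, ← hY.summable.sum_add_tsum_nat_add M]
  exact le_add_of_nonneg_left (Finset.sum_nonneg fun _ _ => by positivity)

lemma lemmaH (φ : ℕ → ℝ) (hφ : Summable fun n => ‖φ n‖ ^ 2)
    (hb : ∀ k, 1 ≤ k → HasSum (fun n => φ n * φ (n + k)) 0) (M : ℕ) (u v : ℕ → Quaternion ℝ)
    (hu : MemH2 u) (hv : ∀ m, M ≤ m → v m = 0) :
    |∑' n, φ n * (sProd u v n).re| ≤
      √(∑' n, ‖u n‖ ^ 2) * √((∑' n, ‖φ n‖ ^ 2) * ∑ m ∈ Finset.range M, ‖v m‖ ^ 2) := by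
  obtain ⟨hs, hle⟩ := hankel_y φ hφ hb M (fun m => star (v m))
  simp only [norm_star] at hle
  obtain ⟨h1, h2⟩ := cs_sq u _ hu hs
  have h3 : HasSum (fun n => φ n * (sProd u v n).re)
      (∑' k, inner ℝ (u k) (∑ m ∈ Finset.range M, φ (k + m) • star (v m))) := by
    have h4 : ∀ m, Summable (fun k => φ (k + m) * (u k * v m).re) := by
      intro m
      have := (cs_sq u (fun k => φ (k + m) • star (v m)) hu (by
        simp only [norm_smul, mul_pow]
        exact ((summable_nat_add_iff m).2 hφ).mul_right _)).1
      refine this.congr fun k => ?_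
      rw [real_inner_smul_right, Quaternion.inner_def, star_star]
    have h5 : HasSum (fun n => ∑ m ∈ Finset.range M, φ n * (shiftR m u n * v m).re)
        (∑ m ∈ Finset.range M, ∑' k, φ (k + m) * (u k * v m).re) := by
      refine hasSum_sum fun m _ => hasSum_shift m ?_ ?_
      · intro n hn
        rw [shiftR, if_neg (by omega), zero_mul, Quaternion.re_zero, mul_zero]
      · simpa [shiftR] using (h4 m).hasSum
    convert h5 using 1
    · funext n
      rw [sProd_shift u v (Finset.range M) (fun j hj => hv j (by simpa using hj)), ← Finset.mul_sum]
      congr 1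
      exact re_sumQ _ _
    · rw [← Summable.tsum_finsetSum fun m _ => h4 m]
      refine tsum_congr fun k => ?_
      rw [inner_sum]
      refine Finset.sum_congr rfl fun m _ => ?_
      rw [real_inner_smul_right, Quaternion.inner_def, star_star]
  rw [h3.tsum_eq]
  refine h2.trans ?_
  gcongr

lemma N2_toReal (y : ℕ → Quaternion ℝ) (hy : MemH2 y) : (N2 y).toReal = ∑' n, ‖y n‖ ^ 2 := by
  rw [N2_eq y hy, ENNReal.toReal_ofReal (tsum_nonneg fun _ => by positivity)]

lemma pair_bound (φ : ℕ → ℝ) (hφ : Summable fun n => ‖φ n‖ ^ 2) (y : ℕ → Quaternion ℝ) (hy : MemH2 y) :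
    Summable (fun n => φ n * (y n).re) ∧
    |∑' n, φ n * (y n).re| ≤ √(∑' n, ‖φ n‖ ^ 2) * √((N2 y).toReal) := by
  have h := cs_sq (fun n => ((φ n : ℝ) : Quaternion ℝ)) y (by simpa using hφ) hy
  have e : ∀ n, inner ℝ ((φ n : ℝ) : Quaternion ℝ) (y n) = φ n * (y n).re := by
    intro n
    rw [Quaternion.inner_def]; simp
  simp only [e] at h
  rw [N2_toReal y hy]
  simpa using h

lemma lemmaL (φ : ℕ → ℝ) (hφ : Summable fun n => ‖φ n‖ ^ 2)
    (hb : ∀ k, 1 ≤ k → HasSum (fun n => φ n * φ (n + k)) 0) (u : ℕ → Quaternion ℝ)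
    (hu : MemH2 u) (hm : IsMult u) :
    |∑' n, φ n * (sProd u (conjS u) n).re| ≤ (∑' n, ‖u n‖ ^ 2) * √(∑' n, ‖φ n‖ ^ 2) := by
  have hcu : MemH2 (conjS u) := by
    unfold MemH2 at *; simpa [conjS] using hu
  have hbound : ∀ N, |∑' n, φ n * (sProd u (conjS u) n).re| ≤
      (∑' n, ‖u n‖ ^ 2) * √(∑' n, ‖φ n‖ ^ 2) + √(∑' n, ‖φ n‖ ^ 2) *
        √((N2 (sProd u (fun n => conjS u n - truncS (conjS u) N n))).toReal) := by
    intro N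
    have hd : MemH2 (fun n => conjS u n - truncS (conjS u) N n) := by
      refine Summable.of_nonneg_of_le (fun _ => by positivity) (fun n => ?_) hcu
      by_cases h : n < N
      · simp [truncS, h]
      · simp [truncS, h]
    have ht := poly_memH2 _ (truncS_poly (conjS u) N)
    obtain ⟨s1, b1⟩ := pair_bound φ hφ _ (hm.memH2 hd)
    obtain ⟨s2, -⟩ := pair_bound φ hφ _ (hm.memH2 ht)
    have e : ∀ n, φ n * (sProd u (conjS u) n).re = φ n * (sProd u (truncS (conjS u) N) n).re +
        φ n * (sProd u (fun n => conjS u n - truncS (conjS u) N n) n).re := by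
      intro n
      rw [sProd_sub, Quaternion.re_sub]; ring
    rw [tsum_congr e, s2.tsum_add s1]
    refine (abs_add_le _ _).trans (add_le_add ?_ b1)
    refine (lemmaH φ hφ hb N u _ hu (fun m h => by simp [truncS, show ¬ m < N by omega])).trans ?_
    have h1 : ∑ m ∈ Finset.range N, ‖truncS (conjS u) N m‖ ^ 2 ≤ ∑' n, ‖u n‖ ^ 2 := by
      have : ∀ m ∈ Finset.range N, ‖truncS (conjS u) N m‖ ^ 2 = ‖u m‖ ^ 2 := by
        intro m h
        simp at h
        simp [truncS, h, conjS]
      rw [Finset.sum_congr rfl this]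
      exact hu.sum_le_tsum _ (fun _ _ => by positivity)
    have hA : 0 ≤ ∑' n, ‖u n‖ ^ 2 := tsum_nonneg fun _ => by positivity
    have hP : 0 ≤ ∑' n, ‖φ n‖ ^ 2 := tsum_nonneg fun _ => by positivity
    calc _ ≤ √(∑' n, ‖u n‖ ^ 2) * √((∑' n, ‖φ n‖ ^ 2) * ∑' n, ‖u n‖ ^ 2) := by gcongr
      _ = (√(∑' n, ‖u n‖ ^ 2) * √(∑' n, ‖u n‖ ^ 2)) * √(∑' n, ‖φ n‖ ^ 2) := by
        rw [Real.sqrt_mul hP]; ring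
      _ = _ := by rw [Real.mul_self_sqrt hA]
  obtain ⟨K, hK, hKm⟩ := hm
  have t1 : Tendsto (fun N => N2 (sProd u (fun n => conjS u n - truncS (conjS u) N n))) atTop (𝓝 0) := by
    refine tendsto_of_tendsto_of_tendsto_of_le_of_le tendsto_const_nhds
      (h := fun N => K * N2 (fun n => conjS u n - truncS (conjS u) N n)) ?_ (fun _ => bot_le) (fun N => hKm _)
    have := ENNReal.Tendsto.const_mul (truncS_tendsto _ hcu) (Or.inr hK)
    simpa using this
  have t2 := (ENNReal.tendsto_toReal ENNReal.zero_ne_top).comp t1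
  have t3 := ((Real.continuous_sqrt.tendsto _).comp t2).const_mul (√(∑' n, ‖φ n‖ ^ 2))
  have t4 := t3.const_add ((∑' n, ‖u n‖ ^ 2) * √(∑' n, ‖φ n‖ ^ 2))
  have := ge_of_tendsto' t4 hbound
  simpa using this

lemma real_of_conj (a : ℕ → Quaternion ℝ) (h : conjS a = a) (n : ℕ) : a n = ((a n).re : Quaternion ℝ) := by
  have := congrFun h n
  exact Quaternion.star_eq_self.1 this

lemma symm_conj (a : ℕ → Quaternion ℝ) : conjS (symmS a) = symmS a := by
  rw [symmS, conj_sProd, conj_conj]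

lemma sProd_comm_real (p a : ℕ → Quaternion ℝ) (h : conjS p = p) : sProd p a = sProd a p := by
  funext n
  rw [sProd, sProd, ← Finset.sum_range_reflect]
  refine Finset.sum_congr rfl fun k hk => ?_
  have : k ≤ n := by simp at hk; omega
  rw [show n + 1 - 1 - k = n - k by omega, show n - (n - k) = k by omega,
    real_of_conj p h (n - k)]
  exact (Quaternion.coe_commutes _ _)

lemma pair_eq (f p : ℕ → Quaternion ℝ) (hp : IsPolyQ p) (φ : ℕ → ℝ)
    (ha : ∀ j, HasSum (fun n => shiftR j (fun n => (symmS f n).re) n * φ n)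
      (if j = 0 then (symmS f 0).re else 0)) :
    ∑' n, φ n * (sProd (sProd f p) (conjS (sProd f p)) n).re = ‖sProd f p 0‖ ^ 2 := by
  have e1 : sProd (sProd f p) (conjS (sProd f p)) = sProd (symmS f) (symmS p) := by
    have : sProd (sProd f p) (conjS (sProd f p)) = sProd f (sProd (symmS p) (conjS f)) := by
      rw [conj_sProd, symmS]; simp only [sProd_assoc]
    rw [this, sProd_comm_real _ _ (symm_conj p), symmS, ← sProd_assoc]
    rfl
  rw [e1]
  obtain ⟨N, hN⟩ := poly_mul p _ hp (poly_conj p hp)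
  have e2 : ∀ n, φ n * (sProd (symmS f) (symmS p) n).re =
      ∑ j ∈ Finset.range (N + 1), (symmS p j).re * (shiftR j (fun n => (symmS f n).re) n * φ n) := by
    intro n
    rw [sProd_shift (symmS f) (symmS p) (Finset.range (N+1)) (fun j hj => hN j (by simp at hj; omega)),
      re_sumQ, Finset.mul_sum]
    refine Finset.sum_congr rfl fun j _ => ?_
    rw [real_of_conj _ (symm_conj p) j]
    simp only [shiftR]
    split_ifs
    · simp; ring
    · rw [zero_mul, zero_mul, Quaternion.re_zero]; simp
  rw [tsum_congr e2]
  have h := hasSum_sum (s := Finset.range (N+1)) fun j _ => (ha j).mul_left (symmS p j).re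
  rw [h.tsum_eq, Finset.sum_eq_single 0]
  · have z : ∀ a : ℕ → Quaternion ℝ, (symmS a 0).re = ‖a 0‖ ^ 2 := by
      intro a
      simp only [symmS, sProd, conjS, zero_add, Finset.sum_range_one, Nat.sub_zero]
      rw [sq, ← Quaternion.normSq_eq_norm_mul_self, Quaternion.self_mul_star]
      rfl
    rw [if_pos rfl, z, z]
    simp [sProd]; ring
  · intro j _ hj; simp [hj]
  · intro h; simp at h

lemma symm_of_cyclic (f : ℕ → Quaternion ℝ) (hf : MemHinf f) (h : IsCyclicQ f) :
    IsCyclicQ (symmS f) := by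
  have hfm := isMult_of_memHinf f hf
  have hcf : MemH2 (conjS f) := by
    have := hf.1
    unfold MemH2 at *; simpa [conjS] using this
  have hs : MemH2 (symmS f) := hfm.memH2 hcf
  have hreal := real_of_conj _ (symm_conj f)
  have hg : Summable fun n => ‖(symmS f n).re‖ ^ 2 := by
    refine hs.congr fun n => ?_
    conv_lhs => rw [hreal n]
    simp
  obtain ⟨φ, hφ, ha, hb, hc, hd⟩ := lemmaR (fun n => (symmS f n).re) hg
  have hone : MemH2 oneS := poly_memH2 _ ⟨0, fun n hn => by simp [oneS, constS]; omega⟩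
  have hΦ : (φ 0) ^ 2 ≤ φ 0 := by
    have := hφ.le_tsum 0 (fun _ _ => by positivity)
    rw [hc] at this
    simpa using this
  have h0 : 0 ≤ φ 0 := (sq_nonneg _).trans hΦ
  have key : ∀ ε : ℝ, 0 < ε → ε ≤ 1 / 4 → ∃ x : ℝ, 1 / 2 ≤ x ∧ x ^ 2 ≤ (x ^ 2 + ε) * √(φ 0) := by
    intro ε hε hε4
    obtain ⟨p, hp, hpd⟩ := (h.2 oneS hone).2 (ENNReal.ofReal ε) (by simpa using hε)
    have hum : IsMult (sProd f p) := hfm.mul (isMult_of_memHinf p (poly_memHinf p hp))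
    have hu : MemH2 (sProd f p) := hfm.memH2 (poly_memH2 p hp)
    have hL := lemmaL φ hφ hb _ hu hum
    rw [pair_eq f p hp φ ha, hc] at hL
    generalize sProd f p = u at *
    change N2 (fun n => u n - oneS n) < _ at hpd
    have hdm : MemH2 (fun n => u n - oneS n) := (memH2_iff _).2 (hpd.trans_le le_top).ne
    rw [N2_eq _ hdm, ENNReal.ofReal_lt_ofReal_iff hε, hdm.tsum_eq_zero_add] at hpd
    have e1 : ∀ n, ‖u (n+1) - oneS (n+1)‖ ^ 2 = ‖u (n+1)‖ ^ 2 := by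
      intro n; simp [oneS, constS]
    rw [tsum_congr e1] at hpd
    rw [hu.tsum_eq_zero_add] at hL
    have hT : 0 ≤ ∑' n, ‖u (n+1)‖ ^ 2 := tsum_nonneg fun _ => by positivity
    have ho : oneS 0 = (1 : Quaternion ℝ) := by simp [oneS, constS]
    beta_reduce at hpd
    rw [ho] at hpd
    have hn : 1 ≤ ‖u 0 - 1‖ + ‖u 0‖ := by
      have := norm_sub_le (u 0) (u 0 - 1)
      simp at this
      linarith
    refine ⟨‖u 0‖, ?_, ?_⟩
    · by_contra hlt
      nlinarith [norm_nonneg (u 0 - 1), norm_nonneg (u 0)]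
    · rw [abs_of_nonneg (by positivity)] at hL
      refine hL.trans ?_
      gcongr
      nlinarith [sq_nonneg ‖u 0 - 1‖]
  have hφ1 : φ 0 = 1 := by
    by_contra hne
    have hlt : φ 0 < 1 := lt_of_le_of_ne (by nlinarith) hne
    have hs1 : √(φ 0) < 1 := by rw [Real.sqrt_lt' one_pos]; simpa using hlt
    have hs0 := Real.sqrt_nonneg (φ 0)
    obtain ⟨x, hx, hx2⟩ := key ((1 - √(φ 0)) / 8) (by linarith) (by linarith)
    have hx4 : 1 / 4 ≤ x ^ 2 := by nlinarith
    have hs2 := sub_pos.2 hs1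
    nlinarith [mul_nonneg (sub_nonneg.2 hx4) hs2.le, mul_pos hs2 hs2]
  refine ⟨hs, fun y hy => ⟨hy, fun ε hε => ?_⟩⟩
  have hε4 : 0 < ε / 4 := ENNReal.div_pos hε.ne' (by norm_num)
  obtain ⟨N, hN⟩ := ((truncS_tendsto y hy).eventually (gt_mem_nhds hε4)).exists
  have hr := truncS_poly y N
  generalize truncS y N = r at hN hr
  obtain ⟨K, hK, hKm⟩ := poly_right r hr
  obtain ⟨δ, hδ, hδK⟩ : ∃ δ : ℝ, 0 < δ ∧ K * ENNReal.ofReal δ < ε / 4 := by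
    have t : Tendsto (fun δ : ℝ => K * ENNReal.ofReal δ) (𝓝[>] 0) (𝓝 0) := by
      have := ENNReal.Tendsto.const_mul
        ((ENNReal.continuous_ofReal.tendsto 0).mono_left (nhdsWithin_le_nhds (s := Set.Ioi 0))) (Or.inr hK)
      simpa using this
    obtain ⟨δ, h1, h2⟩ := ((t.eventually (gt_mem_nhds hε4)).and self_mem_nhdsWithin).exists
    exact ⟨δ, h2, h1⟩
  obtain ⟨c, S, hS, hsum⟩ := hd hφ1 δ hδ
  let P : ℕ → Quaternion ℝ := fun n => ((c n : ℝ) : Quaternion ℝ)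
  have hP : IsPolyQ P := by
    refine ⟨c.support.sup id, fun n hn => ?_⟩
    have : n ∉ c.support := fun hc => by
      have := Finset.le_sup (f := id) hc
      simp at this hn; omega
    simp [P, Finsupp.notMem_support_iff.1 this]
  have hPn : ∀ n, sProd (symmS f) P n - oneS n =
      (((∑ j ∈ c.support, c j * shiftR j (fun n => (symmS f n).re) n) - (if n = 0 then 1 else 0) : ℝ) : Quaternion ℝ) := by
    intro n
    rw [sProd_shift (symmS f) P c.support (fun j hj => by simp [P, Finsupp.notMem_support_iff.1 hj]),
      Quaternion.coe_sub]
    congr 1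
    · rw [show ∀ x : ℝ, (x : Quaternion ℝ) = algebraMap ℝ (Quaternion ℝ) x from fun _ => rfl, map_sum]
      refine Finset.sum_congr rfl fun j _ => ?_
      change _ = ((c j * shiftR j (fun n => (symmS f n).re) n : ℝ) : Quaternion ℝ)
      simp only [shiftR, P]
      split_ifs
      · rw [hreal (n - j)]; simp [mul_comm]
      · simp
    · simp only [oneS, constS]; split_ifs <;> simp
  have hPd : N2 (fun n => sProd (symmS f) P n - oneS n) ≤ ENNReal.ofReal δ := by
    have e : ∀ n, ‖sProd (symmS f) P n - oneS n‖ ^ 2 = ‖(∑ j ∈ c.support, c j * shiftR j (fun n => (symmS f n).re) n) - (if n = 0 then 1 else 0)‖ ^ 2 := by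
      intro n; rw [hPn n, Quaternion.norm_coe]
    have hsum' := hasSum_congrR hsum e
    rw [N2_eq _ hsum'.summable, hsum'.tsum_eq]
    exact ENNReal.ofReal_le_ofReal hS.le
  refine ⟨sProd P r, poly_mul _ _ hP hr, ?_⟩
  have h1 : h2distSq (sProd (symmS f) (sProd P r)) r < ε / 4 := by
    have := hKm (fun n => sProd (symmS f) P n - oneS n)
    rw [sub_sProd, one_sProd, sProd_assoc] at this
    exact (this.trans (by gcongr)).trans_lt hδK
  have h2 : h2distSq r y < ε / 4 := by
    change N2 (fun n => r n - y n) < _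
    rwa [N2_sub_comm]
  refine (h2dist_triangle _ r _).trans_lt ?_
  have h4 : ε = 2 * (ε / 4) + 2 * (ε / 4) := by
    rw [← add_mul, show (2 : ℝ≥0∞) + 2 = 4 by norm_num, ENNReal.mul_div_cancel (by norm_num) (by norm_num)]
  calc _ < 2 * (ε / 4) + 2 * (ε / 4) := by
        apply ENNReal.add_lt_add <;> exact (ENNReal.mul_lt_mul_iff_right (by norm_num) (by norm_num)).2 (by assumption)
    _ = ε := h4.symm

/-- For `f ∈ H^∞(𝔹)`, `f` is cyclic in `H²(𝔹)` if and only if its symmetrization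
`fˢ = f * fᶜ` is cyclic in `H²(𝔹)`. -/
theorem cyclic_iff_symm_cyclic (f : ℕ → Quaternion ℝ) (hf : MemHinf f) :
    IsCyclicQ f ↔ IsCyclicQ (symmS f) := by
  exact ⟨symm_of_cyclic f hf, cyclic_of_symm f hf⟩
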